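/- Let G be an oriented graph, x, y ∈ V(G), and T ⊆ V(G) \ {x, y} with |T| = 11, such that both {x} ∪ T and {y} ∪ T induce tournaments in G. Then there exists Z ⊆ T with |Z| = 7 such that both G[{x} ∪ Z] and G[{y} ∪ Z] have perfect T_4-tilings (each is partitioned into two vertex-disjoint copies of the transitive tournament T_4). -/

import Mathlib

open Finset

/-- An oriented graph: at most one directed edge between any pair of vertices. -/
structure OrientedGraph (V : Type*) where
  adj : V → V → Prop
  asymm : ∀ u v, adj u v → ¬ adj v u

namespace OrientedGraph

variable {V : Type*}

/-- A tournament: a complete oriented graph. -/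
def IsTournament (G : OrientedGraph V) : Prop :=
  ∀ u v : V, u ≠ v → G.adj u v ∨ G.adj v u

/-- `U` is the vertex set of a copy of the transitive tournament on `k` vertices in `G`. -/
def IsTTCopy (G : OrientedGraph V) (k : ℕ) (U : Finset V) : Prop :=
  ∃ f : Fin k ↪ V, Finset.univ.map f = U ∧
    ∀ i j : Fin k, i < j → G.adj (f i) (f j)

/-- Total degree of a vertex: the number of edges incident to it. -/
noncomputable def degree [Fintype V] (G : OrientedGraph V) (v : V) : ℕ :=
  Nat.card {u : V // G.adj v u ∨ G.adj u v}

/-- Minimum total degree. -/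
noncomputable def minDegree [Fintype V] (G : OrientedGraph V) : ℕ :=
  sInf (Set.range G.degree)

/-- Number of (directed) edges. -/
noncomputable def edgeCount [Fintype V] (G : OrientedGraph V) : ℕ :=
  Nat.card {p : V × V // G.adj p.1 p.2}

section
variable [Fintype V] [DecidableEq V]

/-- A fractional `T_k`-tiling: a weight function on copies of the transitive tournament
`T_k` such that every vertex has total incident weight at most `1`. -/
def IsFracTiling (G : OrientedGraph V) (k : ℕ) (w : Finset V → ℝ) : Prop :=
  (∀ U, 0 ≤ w U) ∧ (∀ U, ¬ G.IsTTCopy k U → w U = 0) ∧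
    ∀ v : V, ∑ U ∈ Finset.univ.filter (fun U => v ∈ U), w U ≤ 1

/-- A perfect fractional `T_k`-tiling: total weight `n/k`. -/
def HasPerfectFracTiling (G : OrientedGraph V) (k : ℕ) : Prop :=
  ∃ w : Finset V → ℝ, G.IsFracTiling k w ∧
    ∑ U : Finset V, w U = (Fintype.card V : ℝ) / k

/-- A perfect `T_k`-tiling: vertex-disjoint copies of `T_k` covering all vertices. -/
def HasPerfectTiling (G : OrientedGraph V) (k : ℕ) : Prop :=
  ∃ P : Finset (Finset V), (∀ U ∈ P, G.IsTTCopy k U) ∧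
    (P : Set (Finset V)).PairwiseDisjoint id ∧ P.sup id = Finset.univ

end

end OrientedGraph

/-- The oriented Ramsey number `r(k)`: the least `m` such that every tournament on `m`
vertices contains a copy of the transitive tournament `T_k`. -/
noncomputable def oRamsey (k : ℕ) : ℕ :=
  sInf {m | ∀ G : OrientedGraph (Fin m), G.IsTournament → ∃ U, G.IsTTCopy k U}

/-- `trs k`: the least (positive) `n` such that every tournament on `n` vertices has a
perfect fractional `T_k`-tiling. -/
noncomputable def trs (k : ℕ) : ℕ :=
  sInf {n | 0 < n ∧ ∀ G : OrientedGraph (Fin n), G.IsTournament → G.HasPerfectFracTiling k}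

/-- `trInt k`: the least (positive) `n` such that every tournament on `n` vertices has a
perfect `T_k`-tiling. -/
noncomputable def trInt (k : ℕ) : ℕ :=
  sInf {n | 0 < n ∧ ∀ G : OrientedGraph (Fin n), G.IsTournament → G.HasPerfectTiling k}


namespace OrientedGraph

variable {V : Type*} {G : OrientedGraph V}

theorem irrefl (G : OrientedGraph V) (v : V) : ¬ G.adj v v := fun h => G.asymm v v h h

/-- `G` restricted to `S` is a tournament. -/
def IsTournamentOn (G : OrientedGraph V) (S : Finset V) : Prop :=
  ∀ u ∈ S, ∀ v ∈ S, u ≠ v → G.adj u v ∨ G.adj v u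

theorem IsTournamentOn.mono {S T : Finset V} (hT : G.IsTournamentOn T) (h : S ⊆ T) :
    G.IsTournamentOn S := fun u hu v hv => hT u (h hu) v (h hv)

/-- The oriented graph obtained by reversing all edges. -/
def rev (G : OrientedGraph V) : OrientedGraph V where
  adj u v := G.adj v u
  asymm u v h := G.asymm v u h

theorem IsTTCopy.of_rev {k : ℕ} {U : Finset V} (h : G.rev.IsTTCopy k U) : G.IsTTCopy k U := by
  obtain ⟨f, rfl, hf⟩ := h
  refine ⟨Fin.revPerm.toEmbedding.trans f, ?_, fun i j hij => hf _ _ (Fin.rev_lt_rev.2 hij)⟩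
  rw [← Finset.map_map, Finset.map_univ_equiv]

theorem IsTTCopy.card_eq {k : ℕ} {U : Finset V} (h : G.IsTTCopy k U) : U.card = k := by
  obtain ⟨f, rfl, -⟩ := h
  simp

variable [DecidableEq V]

theorem isTTCopy_toFinset {l : List V} (h : l.Pairwise G.adj) :
    G.IsTTCopy l.length l.toFinset := by
  have hget : ∀ i j : Fin l.length, i < j → G.adj (l.get i) (l.get j) :=
    List.pairwise_iff_get.1 h
  have hinj : Function.Injective l.get := by
    intro i j hij
    by_contra hne
    rcases lt_or_gt_of_ne hne with hlt | hlt
    · exact G.irrefl _ (hij ▸ hget i j hlt)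
    · exact G.irrefl _ (hij ▸ hget j i hlt)
  refine ⟨⟨l.get, hinj⟩, ?_, hget⟩
  ext v
  simp [List.mem_iff_get]

/-- `S` is partitioned into two copies of `T_4`. -/
def IsTiled (G : OrientedGraph V) (S : Finset V) : Prop :=
  ∃ A B : Finset V, A ∪ B = S ∧ Disjoint A B ∧ G.IsTTCopy 4 A ∧ G.IsTTCopy 4 B

/-- Some `7`-subset of `T` can be tiled together with `x` as well as together with `y`. -/
def Linked (G : OrientedGraph V) (x y : V) (T : Finset V) : Prop :=
  ∃ Z ⊆ T, Z.card = 7 ∧ G.IsTiled (insert x Z) ∧ G.IsTiled (insert y Z)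

theorem Linked.symm {x y : V} {T : Finset V} (h : G.Linked x y T) : G.Linked y x T := by
  obtain ⟨Z, hZ, hc, hx, hy⟩ := h
  exact ⟨Z, hZ, hc, hy, hx⟩

theorem Linked.of_rev {x y : V} {T : Finset V} (h : G.rev.Linked x y T) : G.Linked x y T := by
  obtain ⟨Z, hZ, hc, ⟨A, B, h₁, h₂, hA, hB⟩, ⟨C, D, h₃, h₄, hC, hD⟩⟩ := h
  exact ⟨Z, hZ, hc, ⟨A, B, h₁, h₂, hA.of_rev, hB.of_rev⟩, ⟨C, D, h₃, h₄, hC.of_rev, hD.of_rev⟩⟩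

/-- Some vertex of a tournament on at least `2 * k` vertices has `k` out-neighbours. -/
theorem IsTournamentOn.exists_outneighbors {S : Finset V} {k : ℕ} (hS : G.IsTournamentOn S)
    (hk : 2 * k ≤ S.card) (h0 : 0 < k) : ∃ v ∈ S, ∃ N ⊆ S, N.card = k ∧ ∀ u ∈ N, G.adj v u := by
  classical
  suffices h : ∃ v ∈ S, k ≤ (S.bipartiteAbove G.adj v).card by
    obtain ⟨v, hv, hkv⟩ := h
    obtain ⟨N, hN, hNk⟩ := exists_subset_card_eq hkv
    exact ⟨v, hv, N, hN.trans (filter_subset _ _), hNk, fun u hu => (mem_filter.1 (hN hu)).2⟩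
  by_contra! hlt
  have hdeg : ∀ v ∈ S,
      S.card ≤ (S.bipartiteAbove G.adj v).card + (S.bipartiteBelow G.adj v).card + 1 := by
    intro v hv
    have hsub : S ⊆ insert v (S.bipartiteAbove G.adj v ∪ S.bipartiteBelow G.adj v) := by
      intro u hu
      rcases eq_or_ne v u with rfl | hne
      · simp
      · rcases hS v hv u hu hne with h | h <;> simp [h, hu]
    exact (card_le_card hsub).trans ((card_insert_le _ _).trans
      (Nat.succ_le_succ (card_union_le _ _)))
  have hsum := sum_le_sum hdeg
  have hout : ∑ v ∈ S, (S.bipartiteAbove G.adj v).card ≤ ∑ _v ∈ S, (k - 1) :=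
    sum_le_sum fun v hv => Nat.le_sub_one_of_lt (hlt v hv)
  simp only [sum_add_distrib, ← sum_card_bipartiteAbove_eq_sum_card_bipartiteBelow, sum_const,
    smul_eq_mul] at hsum hout
  obtain ⟨m, rfl⟩ := Nat.exists_eq_add_of_lt h0
  simp only [zero_add, Nat.add_sub_cancel] at hout
  nlinarith

/-- `r(3) ≤ 4`. -/
theorem IsTournamentOn.exists_pairwise_three {S : Finset V} (hS : G.IsTournamentOn S)
    (hcard : 4 ≤ S.card) :
    ∃ a ∈ S, ∃ b ∈ S, ∃ c ∈ S, [a, b, c].Pairwise G.adj := by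
  obtain ⟨v, hv, N, hNS, hN, hvN⟩ := hS.exists_outneighbors (k := 2) hcard two_pos
  obtain ⟨a, b, hab, rfl⟩ := Finset.card_eq_two.1 hN
  have ha : a ∈ S := hNS (by simp)
  have hb : b ∈ S := hNS (by simp)
  have hva := hvN a (by simp)
  have hvb := hvN b (by simp)
  rcases hS a ha b hb hab with h | h
  · exact ⟨v, hv, a, ha, b, hb, by simp [*]⟩
  · exact ⟨v, hv, b, hb, a, ha, by simp [*]⟩

/-- `r(4) ≤ 8`. -/
theorem IsTournamentOn.exists_isTTCopy_four {S : Finset V} (hS : G.IsTournamentOn S)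
    (hcard : 8 ≤ S.card) : ∃ U ⊆ S, G.IsTTCopy 4 U := by
  obtain ⟨v, hv, N, hNS, hN, hvN⟩ := hS.exists_outneighbors (k := 4) hcard four_pos
  obtain ⟨a, ha, b, hb, c, hc, habc⟩ := (hS.mono hNS).exists_pairwise_three hN.ge
  refine ⟨[v, a, b, c].toFinset, ?_, isTTCopy_toFinset (List.pairwise_cons.2 ⟨?_, habc⟩)⟩
  · intro u
    simp only [List.mem_toFinset, List.mem_cons, List.not_mem_nil, or_false]
    rintro (rfl | rfl | rfl | rfl)
    exacts [hv, hNS ha, hNS hb, hNS hc]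
  · simp [hvN a ha, hvN b hb, hvN c hc]

/-- A triple forming a `T_4` with `x` and with `y` can be completed using `r(4) ≤ 8`. -/
theorem linked_of_common_triple {x y : V} {T S : Finset V} (hT : G.IsTournamentOn T)
    (hxT : x ∉ T) (hyT : y ∉ T) (hcard : T.card = 11) (hST : S ⊆ T) (hS : S.card = 3)
    (hx : G.IsTTCopy 4 (insert x S)) (hy : G.IsTTCopy 4 (insert y S)) : G.Linked x y T := by
  obtain ⟨U, hU, hUT⟩ := (hT.mono (S := T \ S) sdiff_subset).exists_isTTCopy_four
    (by rw [card_sdiff_of_subset hST]; omega)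
  have hUT' : U ⊆ T := hU.trans sdiff_subset
  have hSU : Disjoint S U := (disjoint_sdiff.mono_right hU)
  refine ⟨S ∪ U, union_subset hST hUT', ?_, ⟨insert x S, U, ?_, ?_, hx, hUT⟩,
    ⟨insert y S, U, ?_, ?_, hy, hUT⟩⟩
  · rw [card_union_of_disjoint hSU, hS, hUT.card_eq]
  · rw [insert_union]
  · exact disjoint_insert_left.2 ⟨fun h => hxT (hUT' h), hSU⟩
  · rw [insert_union]
  · exact disjoint_insert_left.2 ⟨fun h => hyT (hUT' h), hSU⟩

theorem isTiled_of_perm {x : V} {s l : List V} (hl : l.Perm (x :: s)) (hnd : (x :: s).Nodup)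
    (hs : s.length = 7) (h₁ : (l.take 4).Pairwise G.adj) (h₂ : (l.drop 4).Pairwise G.adj) :
    G.IsTiled (insert x s.toFinset) := by
  have hlen : l.length = 8 := by simp [hl.length_eq, hs]
  refine ⟨(l.take 4).toFinset, (l.drop 4).toFinset, ?_, ?_, ?_, ?_⟩
  · rw [← List.toFinset_append, List.take_append_drop, List.toFinset_eq_of_perm _ _ hl,
      List.toFinset_cons]
  · refine List.disjoint_toFinset_iff_disjoint.2 (List.disjoint_of_nodup_append ?_)
    rw [List.take_append_drop]
    exact hl.nodup_iff.2 hnd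
  · simpa [hlen] using isTTCopy_toFinset h₁
  · simpa [hlen] using isTTCopy_toFinset h₂

end OrientedGraph

/-- A decision tree proving `OrientedGraph.Linked`. The vertices of `T` are numbered from `0`, and
`8`, `9` stand for `x`, `y`. A leaf holds orderings of `S ∪ {8}` and `S ∪ {9}`: either both are
transitive and `S` is a triple, or both split into two transitive quadruples and `S` has size
`7`. An inner node branches on the direction of an edge. -/
inductive LinkTree
  | triple (p q : List ℕ)
  | tiling (p q : List ℕ)
  | split (i j : ℕ) (l r : LinkTree)

namespace LinkTree

/-- `p` and `q` list `S ∪ {8}` and `S ∪ {9}` for some set `S` of `n` numbers below `8`. -/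
def Covers (n : ℕ) (p q : List ℕ) : Prop :=
  p.Perm (8 :: p.erase 8) ∧ q.Perm (9 :: p.erase 8) ∧ (p.erase 8).length = n ∧
    (p.erase 8).Nodup ∧ ∀ i ∈ p.erase 8, i < 8

/-- The tree is a valid proof, given the edges in `K`. -/
def Valid : LinkTree → List (ℕ × ℕ) → Prop
  | triple p q, K => Covers 3 p q ∧ p.Pairwise (fun i j => (i, j) ∈ K) ∧
      q.Pairwise (fun i j => (i, j) ∈ K)
  | tiling p q, K => Covers 7 p q ∧ (p.take 4).Pairwise (fun i j => (i, j) ∈ K) ∧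
      (p.drop 4).Pairwise (fun i j => (i, j) ∈ K) ∧ (q.take 4).Pairwise (fun i j => (i, j) ∈ K) ∧
      (q.drop 4).Pairwise (fun i j => (i, j) ∈ K)
  | split i j l r, K => (i ≠ j ∧ i < 8 ∧ j < 8) ∧ l.Valid ((i, j) :: K) ∧ r.Valid ((j, i) :: K)

instance (n : ℕ) (p q : List ℕ) : Decidable (Covers n p q) := by
  unfold Covers
  infer_instance

instance decidableValid : (t : LinkTree) → (K : List (ℕ × ℕ)) → Decidable (t.Valid K)
  | triple p q, K => by unfold Valid; infer_instance
  | tiling p q, K => by unfold Valid; infer_instance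
  | split i j l r, K =>
    have := l.decidableValid ((i, j) :: K)
    have := r.decidableValid ((j, i) :: K)
    by unfold Valid; infer_instance

variable {V : Type*} {G : OrientedGraph V}

theorem pairwise_map {v : ℕ → V} {K : List (ℕ × ℕ)} (hK : ∀ e ∈ K, G.adj (v e.1) (v e.2))
    {p : List ℕ} (hp : p.Pairwise fun i j => (i, j) ∈ K) : (p.map v).Pairwise G.adj :=
  List.pairwise_map.2 (hp.imp fun h => hK _ h)

variable [DecidableEq V]

theorem linked {T : Finset V} (hT : G.IsTournamentOn T) (hcard : T.card = 11) {v : ℕ → V}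
    (hinj : Set.InjOn v {i | i < 8}) (hv : ∀ i < 8, v i ∈ T) (hx : v 8 ∉ T) (hy : v 9 ∉ T)
    (t : LinkTree) : ∀ K : List (ℕ × ℕ), (∀ e ∈ K, G.adj (v e.1) (v e.2)) → t.Valid K →
      G.Linked (v 8) (v 9) T := by
  have hsub : ∀ {s : List ℕ}, (∀ i ∈ s, i < 8) → (s.map v).toFinset ⊆ T := by
    intro s hs u hu
    obtain ⟨i, hi, rfl⟩ := List.mem_map.1 (List.mem_toFinset.1 hu)
    exact hv i (hs i hi)
  have hnodup : ∀ {s : List ℕ}, s.Nodup → (∀ i ∈ s, i < 8) → (s.map v).Nodup := fun hnd hs =>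
    hnd.map_on fun i hi j hj => hinj (hs i hi) (hs j hj)
  induction t with
  | triple p q =>
    rintro K hK ⟨⟨hp, hq, hlen, hnd, hlt⟩, hp', hq'⟩
    refine OrientedGraph.linked_of_common_triple (S := ((p.erase 8).map v).toFinset) hT hx hy hcard
      (hsub hlt) ?_ ?_ ?_
    · rw [List.toFinset_card_of_nodup (hnodup hnd hlt), List.length_map, hlen]
    · have h := OrientedGraph.isTTCopy_toFinset (pairwise_map hK hp')
      rwa [List.toFinset_eq_of_perm _ _ (hp.map v), List.length_map, hp.length_eq, List.length_cons,
        hlen, List.map_cons, List.toFinset_cons] at h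
    · have h := OrientedGraph.isTTCopy_toFinset (pairwise_map hK hq')
      rwa [List.toFinset_eq_of_perm _ _ (hq.map v), List.length_map, hq.length_eq, List.length_cons,
        hlen, List.map_cons, List.toFinset_cons] at h
  | tiling p q =>
    rintro K hK ⟨⟨hp, hq, hlen, hnd, hlt⟩, hp₁, hp₂, hq₁, hq₂⟩
    have hcons : ∀ u ∉ T, (u :: (p.erase 8).map v).Nodup := fun u hu =>
      List.nodup_cons.2 ⟨fun h => hu (hsub hlt (List.mem_toFinset.2 h)), hnodup hnd hlt⟩
    refine ⟨((p.erase 8).map v).toFinset, hsub hlt, ?_, ?_, ?_⟩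
    · rw [List.toFinset_card_of_nodup (hnodup hnd hlt), List.length_map, hlen]
    · refine OrientedGraph.isTiled_of_perm (hp.map v) (hcons _ hx) (by simpa using hlen) ?_ ?_
      · simpa only [List.map_take] using pairwise_map hK hp₁
      · simpa only [List.map_drop] using pairwise_map hK hp₂
    · refine OrientedGraph.isTiled_of_perm (hq.map v) (hcons _ hy) (by simpa using hlen) ?_ ?_
      · simpa only [List.map_take] using pairwise_map hK hq₁
      · simpa only [List.map_drop] using pairwise_map hK hq₂
  | split i j l r ihl ihr =>
    rintro K hK ⟨⟨hij, hi, hj⟩, hl, hr⟩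
    rcases hT _ (hv i hi) _ (hv j hj) (fun h => hij (hinj hi hj h)) with h | h
    · exact ihl _ (List.forall_mem_cons.2 ⟨h, hK⟩) hl
    · exact ihr _ (List.forall_mem_cons.2 ⟨h, hK⟩) hr

theorem linked_of_list {x y : V} {T : Finset V} (hT : G.IsTournamentOn T) (hcard : T.card = 11)
    (hx : x ∉ T) (hy : y ∉ T) {l : List V} (hlen : l.length = 8) (hnd : l.Nodup)
    (hl : ∀ u ∈ l, u ∈ T) (t : LinkTree) (K : List (ℕ × ℕ))
    (hK : ∀ e ∈ K, G.adj ((l ++ [x, y]).getD e.1 x) ((l ++ [x, y]).getD e.2 x))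
    (ht : t.Valid K) : G.Linked x y T := by
  have hget : ∀ i, (hi : i < 8) → (l ++ [x, y]).getD i x = l[i] := by
    intro i hi
    rw [List.getD_append _ _ _ _ (by omega), List.getD_eq_getElem _ _ (by omega)]
  have h8 : (l ++ [x, y]).getD 8 x = x := by
    rw [List.getD_append_right _ _ _ _ (by omega), hlen]; rfl
  have h9 : (l ++ [x, y]).getD 9 x = y := by
    rw [List.getD_append_right _ _ _ _ (by omega), hlen]; rfl
  have h := linked hT hcard (v := fun i => (l ++ [x, y]).getD i x) ?_ ?_ ?_ ?_ t K hK ht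
  · simpa only [h8, h9] using h
  · intro i hi j hj hij
    have hij' : (l ++ [x, y]).getD i x = (l ++ [x, y]).getD j x := hij
    rw [hget i hi, hget j hj] at hij'
    exact hnd.getElem_inj_iff.1 hij'
  · intro i hi
    rw [hget i hi]
    exact hl _ (List.getElem_mem _)
  · rwa [h8]
  · rwa [h9]

end LinkTree

namespace OrientedGraph

variable {V : Type*}

open Classical in
/-- The vertices of `T` joined to `x` and `y` in the directions prescribed by `p` and `q`. -/
noncomputable def typeClass (G : OrientedGraph V) (x y : V) (T : Finset V) (p q : Prop) :
    Finset V :=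
  T.filter fun v => (G.adj v x ↔ p) ∧ (G.adj v y ↔ q)

variable {G : OrientedGraph V} {x y : V} {T : Finset V}

theorem mem_typeClass {p q : Prop} {v : V} :
    v ∈ G.typeClass x y T p q ↔ v ∈ T ∧ (G.adj v x ↔ p) ∧ (G.adj v y ↔ q) := by
  simp [typeClass]

theorem typeClass_subset (p q : Prop) : G.typeClass x y T p q ⊆ T :=
  fun _ hv => (mem_typeClass.1 hv).1

theorem typeClass_swap (p q : Prop) : G.typeClass y x T q p = G.typeClass x y T p q := by
  ext v
  simp only [mem_typeClass, and_comm]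

theorem rev_adj_iff {v : V} (hx : G.adj v x ∨ G.adj x v) : G.rev.adj v x ↔ ¬ G.adj v x :=
  ⟨fun h => G.asymm _ _ h, hx.resolve_left⟩

theorem typeClass_rev (hx : ∀ v ∈ T, G.adj v x ∨ G.adj x v) (hy : ∀ v ∈ T, G.adj v y ∨ G.adj y v)
    (p q : Prop) : G.rev.typeClass x y T p q = G.typeClass x y T (¬ p) (¬ q) := by
  ext v
  simp only [mem_typeClass]
  refine and_congr_right fun hv => ?_
  rw [rev_adj_iff (hx v hv), rev_adj_iff (hy v hv)]
  tauto

/-- A tournament on the eleven vertices of `T`, with `x` and `y` joined to all of them. -/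
structure IsSetup (G : OrientedGraph V) (x y : V) (T : Finset V) : Prop where
  tournament : G.IsTournamentOn T
  card : T.card = 11
  left_notMem : x ∉ T
  right_notMem : y ∉ T
  left_adj : ∀ v ∈ T, G.adj v x ∨ G.adj x v
  right_adj : ∀ v ∈ T, G.adj v y ∨ G.adj y v

theorem IsSetup.swap (hs : G.IsSetup x y T) : G.IsSetup y x T :=
  ⟨hs.1, hs.2, hs.4, hs.3, hs.6, hs.5⟩

theorem IsSetup.rev (hs : G.IsSetup x y T) : G.rev.IsSetup x y T :=
  ⟨fun u hu v hv huv => (hs.1 u hu v hv huv).symm, hs.2, hs.3, hs.4, fun v hv => (hs.5 v hv).symm,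
    fun v hv => (hs.6 v hv).symm⟩

/-- Two cyclic triangles and an edge inside three of the type classes. -/
structure IsConfig (G : OrientedGraph V) (x y : V) (T : Finset V)
    (a₀ a₁ a₂ b₀ b₁ b₂ c₀ c₁ : V) : Prop where
  a₀_mem : a₀ ∈ G.typeClass x y T True True
  a₁_mem : a₁ ∈ G.typeClass x y T True True
  a₂_mem : a₂ ∈ G.typeClass x y T True True
  b₀_mem : b₀ ∈ G.typeClass x y T True False
  b₁_mem : b₁ ∈ G.typeClass x y T True False
  b₂_mem : b₂ ∈ G.typeClass x y T True False
  c₀_mem : c₀ ∈ G.typeClass x y T False True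
  c₁_mem : c₁ ∈ G.typeClass x y T False True
  a₀₁ : G.adj a₀ a₁
  a₁₂ : G.adj a₁ a₂
  a₂₀ : G.adj a₂ a₀
  b₀₁ : G.adj b₀ b₁
  b₁₂ : G.adj b₁ b₂
  b₂₀ : G.adj b₂ b₀
  c₀₁ : G.adj c₀ c₁

variable {a₀ a₁ a₂ b₀ b₁ b₂ c₀ c₁ : V}

theorem IsConfig.rotate_left (h : G.IsConfig x y T a₀ a₁ a₂ b₀ b₁ b₂ c₀ c₁) :
    G.IsConfig x y T a₁ a₂ a₀ b₀ b₁ b₂ c₀ c₁ :=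
  { h with
    a₀_mem := h.a₁_mem, a₁_mem := h.a₂_mem, a₂_mem := h.a₀_mem
    a₀₁ := h.a₁₂, a₁₂ := h.a₂₀, a₂₀ := h.a₀₁ }

theorem IsConfig.rotate_right (h : G.IsConfig x y T a₀ a₁ a₂ b₀ b₁ b₂ c₀ c₁) :
    G.IsConfig x y T a₀ a₁ a₂ b₁ b₂ b₀ c₀ c₁ :=
  { h with
    b₀_mem := h.b₁_mem, b₁_mem := h.b₂_mem, b₂_mem := h.b₀_mem
    b₀₁ := h.b₁₂, b₁₂ := h.b₂₀, b₂₀ := h.b₀₁ }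

theorem IsConfig.nodup (h : G.IsConfig x y T a₀ a₁ a₂ b₀ b₁ b₂ c₀ c₁) :
    [a₀, a₁, a₂, b₀, b₁, b₂, c₀, c₁].Nodup := by
  obtain ⟨a₀_mem, a₁_mem, a₂_mem, b₀_mem, b₁_mem, b₂_mem, c₀_mem, c₁_mem, _, _, _, _, _, _, _⟩ := h
  have hirr := G.irrefl
  simp only [mem_typeClass, iff_true, iff_false] at *
  simp only [List.nodup_cons, List.mem_cons, List.not_mem_nil, or_false, not_or, List.nodup_nil,
    and_true, not_false_eq_true]
  constructorm* _ ∧ _ <;> grind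

variable [DecidableEq V]

theorem card_le_sum_card_typeClass :
    T.card ≤ (G.typeClass x y T True True).card + (G.typeClass x y T True False).card +
      (G.typeClass x y T False True).card + (G.typeClass x y T False False).card := by
  have hsub : T ⊆ G.typeClass x y T True True ∪ G.typeClass x y T True False ∪
      G.typeClass x y T False True ∪ G.typeClass x y T False False := by
    intro v hv
    simp only [mem_union, mem_typeClass]
    tauto
  refine (card_le_card hsub).trans ((card_union_le _ _).trans (Nat.add_le_add_right ?_ _))
  exact (card_union_le _ _).trans (Nat.add_le_add_right (card_union_le _ _) _)

/-- A transitive triple whose vertices all have the same type extends to `T_4` with `x`. -/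
theorem isTTCopy_insert {a b c : V} (habc : [a, b, c].Pairwise G.adj) {p : Prop}
    (hp : ∀ v ∈ [a, b, c], G.adj v x ↔ p) (hx : ∀ v ∈ [a, b, c], G.adj v x ∨ G.adj x v) :
    G.IsTTCopy 4 (insert x [a, b, c].toFinset) := by
  by_cases h : p
  · have h4 := isTTCopy_toFinset (List.pairwise_append.2 ⟨habc, List.pairwise_singleton G.adj x,
      fun u hu v hv => List.mem_singleton.1 hv ▸ (hp u hu).2 h⟩)
    rwa [List.toFinset_eq_of_perm _ _ (List.perm_append_singleton x _), List.toFinset_cons] at h4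
  · have h4 := isTTCopy_toFinset (List.pairwise_cons.2
      ⟨fun v hv => (hx v hv).resolve_left fun h' => h ((hp v hv).1 h'), habc⟩)
    rwa [List.toFinset_cons] at h4

/-- Unless `x` and `y` are linked, every type class with at least three vertices is a cyclic
triangle. -/
theorem typeClass_cyclic (hT : G.IsTournamentOn T) (hxT : x ∉ T) (hyT : y ∉ T)
    (hcard : T.card = 11) (hx : ∀ v ∈ T, G.adj v x ∨ G.adj x v)
    (hy : ∀ v ∈ T, G.adj v y ∨ G.adj y v) (hL : ¬ G.Linked x y T) {p q : Prop}
    (h3 : 3 ≤ (G.typeClass x y T p q).card) :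
    (G.typeClass x y T p q).card = 3 ∧ ∃ a ∈ G.typeClass x y T p q, ∃ b ∈ G.typeClass x y T p q,
      ∃ c ∈ G.typeClass x y T p q, G.adj a b ∧ G.adj b c ∧ G.adj c a := by
  have hno : ∀ a ∈ G.typeClass x y T p q, ∀ b ∈ G.typeClass x y T p q,
      ∀ c ∈ G.typeClass x y T p q, ¬ [a, b, c].Pairwise G.adj := by
    intro a ha b hb c hc habc
    have hmem : ∀ v ∈ [a, b, c], v ∈ G.typeClass x y T p q := by simp [ha, hb, hc]
    refine hL (linked_of_common_triple (S := [a, b, c].toFinset) hT hxT hyT hcard ?_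
      (isTTCopy_toFinset habc).card_eq ?_ ?_)
    · exact fun v hv => typeClass_subset _ _ (hmem v (List.mem_toFinset.1 hv))
    · exact isTTCopy_insert habc (fun v hv => (mem_typeClass.1 (hmem v hv)).2.1)
        fun v hv => hx v (typeClass_subset _ _ (hmem v hv))
    · exact isTTCopy_insert habc (fun v hv => (mem_typeClass.1 (hmem v hv)).2.2)
        fun v hv => hy v (typeClass_subset _ _ (hmem v hv))
  have htour := hT.mono (typeClass_subset (G := G) (x := x) (y := y) p q)
  have heq : (G.typeClass x y T p q).card = 3 := by
    refine le_antisymm ?_ h3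
    by_contra! h4
    obtain ⟨a, ha, b, hb, c, hc, habc⟩ := htour.exists_pairwise_three h4
    exact hno a ha b hb c hc habc
  refine ⟨heq, ?_⟩
  obtain ⟨a, b, c, hab, hac, hbc, hS⟩ := card_eq_three.1 heq
  have ha : a ∈ G.typeClass x y T p q := by simp [hS]
  have hb : b ∈ G.typeClass x y T p q := by simp [hS]
  have hc : c ∈ G.typeClass x y T p q := by simp [hS]
  simp only [List.pairwise_cons, List.mem_cons, List.not_mem_nil, or_false, forall_eq_or_imp,
    forall_eq, IsEmpty.forall_iff, implies_true, List.Pairwise.nil, and_true] at hno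
  rcases htour a ha b hb hab with h₁ | h₁ <;> rcases htour b hb c hc hbc with h₂ | h₂ <;>
    rcases htour a ha c hc hac with h₃ | h₃
  · exact (hno a ha b hb c hc ⟨⟨h₁, h₃⟩, h₂⟩).elim
  · exact ⟨a, ha, b, hb, c, hc, h₁, h₂, h₃⟩
  · exact (hno a ha c hc b hb ⟨⟨h₃, h₁⟩, h₂⟩).elim
  · exact (hno c hc a ha b hb ⟨⟨h₃, h₂⟩, h₁⟩).elim
  · exact (hno b hb a ha c hc ⟨⟨h₁, h₂⟩, h₃⟩).elim
  · exact (hno b hb c hc a ha ⟨⟨h₂, h₁⟩, h₃⟩).elim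
  · exact ⟨a, ha, c, hc, b, hb, h₃, h₂, h₁⟩
  · exact (hno c hc b hb a ha ⟨⟨h₂, h₃⟩, h₁⟩).elim

/-- The edges of a configuration, with `a₀, a₁, a₂, b₀, b₁, b₂, c₀, c₁, x, y` numbered in this
order. -/
def configEdges : List (ℕ × ℕ) :=
  [(0, 1), (1, 2), (2, 0), (3, 4), (4, 5), (5, 3), (6, 7),
    (0, 8), (1, 8), (2, 8), (3, 8), (4, 8), (5, 8), (8, 6), (8, 7),
    (0, 9), (1, 9), (2, 9), (9, 3), (9, 4), (9, 5), (6, 9), (7, 9)]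

theorem IsConfig.linked_of_valid (h : G.IsConfig x y T a₀ a₁ a₂ b₀ b₁ b₂ c₀ c₁)
    (hs : G.IsSetup x y T) (t : LinkTree) (K : List (ℕ × ℕ))
    (hK : ∀ e ∈ K, G.adj ([a₀, a₁, a₂, b₀, b₁, b₂, c₀, c₁, x, y].getD e.1 x)
      ([a₀, a₁, a₂, b₀, b₁, b₂, c₀, c₁, x, y].getD e.2 x))
    (ht : t.Valid (K ++ configEdges)) : G.Linked x y T := by
  refine t.linked_of_list hs.tournament hs.card hs.left_notMem hs.right_notMem
    (l := [a₀, a₁, a₂, b₀, b₁, b₂, c₀, c₁]) rfl h.nodup ?_ _ ?_ ht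
  · obtain ⟨_, _, _, _, _, _, _, _, _, _, _, _, _, _, _⟩ := h
    simp only [mem_typeClass] at *
    simp [*]
  · refine List.forall_mem_append.2 ⟨hK, ?_⟩
    have hx := hs.left_adj
    have hy := hs.right_adj
    obtain ⟨_, _, _, _, _, _, _, _, _, _, _, _, _, _, _⟩ := h
    simp only [mem_typeClass, iff_true, iff_false] at *
    simp only [configEdges, List.forall_mem_cons, List.cons_append, List.nil_append,
      List.getD_cons_zero, List.getD_cons_succ, List.not_mem_nil, IsEmpty.forall_iff,
      implies_true, and_true]
    constructorm* _ ∧ _ <;> grind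

/-- The case analysis for `OrientedGraph.IsConfig.linked_of_adj`. -/
def configTree : LinkTree :=
  .split 1 7
   (.split 2 7
    (.triple [1, 2, 8, 7] [1, 2, 7, 9])
    (.split 0 7
     (.triple [0, 1, 8, 7] [0, 1, 7, 9])
     (.split 3 7
      (.split 4 7
       (.tiling [3, 4, 0, 8, 6, 1, 7, 2] [6, 1, 2, 9, 3, 4, 7, 0])
       (.tiling [3, 4, 0, 8, 6, 1, 7, 2] [6, 1, 2, 9, 3, 7, 4, 0]))
      (.split 4 7
       (.split 0 5
        (.split 1 5
         (.triple [0, 1, 5, 8] [0, 1, 9, 5])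
         (.split 2 5
          (.triple [2, 0, 5, 8] [2, 0, 9, 5])
          (.split 5 7
           (.split 1 4
            (.split 2 4
             (.triple [1, 2, 4, 8] [1, 2, 9, 4])
             (.split 0 6
              (.tiling [4, 0, 5, 8, 6, 1, 7, 2] [0, 6, 1, 9, 4, 5, 7, 2])
              (.tiling [4, 0, 5, 8, 6, 1, 7, 2] [6, 0, 1, 9, 4, 5, 7, 2])))
            (.tiling [4, 0, 5, 8, 6, 1, 7, 2] [6, 7, 2, 9, 4, 0, 5, 1]))
           (.tiling [4, 0, 5, 8, 6, 1, 7, 2] [6, 1, 2, 9, 4, 7, 0, 5]))))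
        (.split 5 7
         (.tiling [4, 5, 0, 8, 6, 1, 7, 2] [6, 1, 2, 9, 4, 5, 7, 0])
         (.tiling [4, 5, 0, 8, 6, 1, 7, 2] [6, 1, 2, 9, 4, 7, 5, 0])))
       (.tiling [3, 4, 0, 8, 6, 1, 7, 2] [6, 1, 2, 9, 7, 3, 4, 0])))))
   (.split 2 4
    (.split 2 3
     (.triple [2, 3, 4, 8] [2, 9, 3, 4])
     (.split 2 5
      (.triple [2, 4, 5, 8] [2, 9, 4, 5])
      (.split 1 4
       (.triple [1, 2, 4, 8] [1, 2, 9, 4])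
       (.split 2 7
        (.split 0 7
         (.triple [2, 0, 8, 7] [2, 0, 7, 9])
         (.split 0 6
          (.split 4 7
           (.split 4 6
            (.tiling [3, 2, 0, 8, 4, 6, 7, 1] [6, 7, 1, 9, 3, 2, 4, 0])
            (.tiling [3, 2, 0, 8, 6, 4, 7, 1] [6, 7, 1, 9, 3, 2, 4, 0]))
           (.split 4 6
            (.split 3 7
             (.tiling [3, 2, 8, 7, 4, 0, 6, 1] [6, 1, 2, 9, 3, 7, 4, 0])
             (.split 5 6
              (.split 1 3
               (.split 1 5
                (.triple [1, 5, 3, 8] [1, 9, 5, 3])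
                (.split 5 7
                 (.tiling [3, 2, 4, 8, 5, 6, 7, 1] [7, 9, 3, 4, 5, 6, 1, 2])
                 (.tiling [4, 0, 8, 6, 7, 5, 1, 3] [7, 9, 5, 3, 4, 0, 6, 1])))
               (.split 5 7
                (.split 3 6
                 (.tiling [3, 0, 1, 8, 5, 6, 2, 7] [7, 0, 1, 9, 5, 3, 6, 2])
                 (.tiling [3, 0, 1, 8, 5, 6, 2, 7] [7, 0, 1, 9, 5, 6, 3, 2]))
                (.tiling [4, 5, 8, 6, 7, 3, 0, 1] [7, 9, 5, 3, 4, 0, 6, 1])))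
              (.split 1 5
               (.tiling [3, 4, 0, 8, 6, 1, 5, 2] [6, 1, 9, 5, 3, 2, 4, 0])
               (.split 5 7
                (.tiling [3, 2, 4, 8, 6, 5, 7, 1] [7, 9, 3, 4, 6, 5, 1, 2])
                (.tiling [3, 2, 4, 8, 6, 7, 5, 1] [7, 9, 3, 4, 6, 5, 1, 2])))))
            (.tiling [3, 2, 0, 8, 6, 7, 4, 1] [6, 7, 1, 9, 3, 2, 4, 0])))
          (.tiling [3, 2, 4, 8, 6, 7, 0, 1] [6, 7, 1, 9, 3, 2, 4, 0])))
        (.tiling [3, 4, 0, 8, 6, 7, 1, 2] [6, 7, 1, 9, 3, 2, 4, 0])))))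
    (.split 2 3
     (.split 2 5
      (.triple [2, 5, 3, 8] [2, 9, 5, 3])
      (.split 1 3
       (.triple [1, 2, 3, 8] [1, 2, 9, 3])
       (.split 2 7
        (.split 0 7
         (.triple [2, 0, 8, 7] [2, 0, 7, 9])
         (.split 3 7
          (.split 3 6
           (.split 4 7
            (.tiling [4, 2, 0, 8, 3, 6, 7, 1] [6, 1, 2, 9, 3, 4, 7, 0])
            (.tiling [4, 2, 0, 8, 3, 6, 7, 1] [6, 1, 2, 9, 3, 7, 4, 0]))
           (.split 4 7
            (.tiling [4, 2, 0, 8, 6, 3, 7, 1] [6, 1, 2, 9, 3, 4, 7, 0])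
            (.tiling [4, 2, 0, 8, 6, 3, 7, 1] [6, 1, 2, 9, 3, 7, 4, 0])))
          (.split 0 5
           (.split 1 5
            (.triple [0, 1, 5, 8] [0, 1, 9, 5])
            (.split 1 4
             (.split 5 6
              (.split 3 6
               (.split 0 6
                (.split 4 7
                 (.split 4 6
                  (.tiling [5, 3, 8, 6, 4, 2, 7, 0] [2, 7, 9, 3, 4, 0, 5, 6])
                  (.tiling [3, 0, 1, 8, 6, 4, 2, 7] [2, 7, 0, 9, 3, 6, 1, 4]))
                 (.tiling [0, 5, 8, 6, 7, 3, 1, 4] [7, 9, 3, 4, 0, 5, 6, 1]))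
                (.tiling [5, 3, 1, 8, 6, 2, 7, 0] [2, 7, 0, 9, 5, 3, 6, 1]))
               (.tiling [0, 5, 1, 8, 6, 2, 7, 3] [7, 0, 1, 9, 5, 6, 2, 3]))
              (.split 0 6
               (.split 5 7
                (.tiling [3, 0, 1, 8, 6, 5, 2, 7] [0, 6, 1, 9, 5, 2, 7, 3])
                (.tiling [2, 3, 0, 8, 6, 7, 5, 1] [2, 7, 9, 3, 0, 6, 5, 1]))
               (.tiling [5, 3, 1, 8, 6, 2, 7, 0] [2, 7, 9, 3, 6, 0, 5, 1])))
             (.tiling [4, 5, 1, 8, 2, 7, 3, 0] [2, 7, 9, 3, 4, 0, 5, 1])))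
           (.split 0 6
            (.split 3 6
             (.split 5 7
              (.tiling [5, 2, 8, 7, 3, 0, 6, 1] [6, 1, 2, 9, 5, 7, 3, 0])
              (.split 1 5
               (.split 1 4
                (.triple [1, 4, 5, 8] [1, 9, 4, 5])
                (.split 4 7
                 (.tiling [4, 2, 8, 7, 3, 0, 6, 1] [6, 2, 7, 9, 3, 4, 0, 1])
                 (.tiling [3, 0, 8, 6, 7, 4, 1, 5] [7, 9, 4, 5, 3, 0, 6, 1])))
               (.split 1 4
                (.split 5 6
                 (.split 4 6
                  (.tiling [4, 5, 8, 6, 2, 7, 3, 0] [2, 7, 9, 3, 4, 5, 0, 6])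
                  (.tiling [3, 4, 0, 8, 5, 6, 1, 2] [6, 1, 9, 4, 5, 2, 3, 0]))
                 (.tiling [4, 2, 0, 8, 6, 7, 5, 1] [6, 7, 1, 9, 4, 5, 2, 0]))
                (.tiling [4, 2, 0, 8, 7, 5, 3, 1] [2, 7, 9, 3, 4, 5, 0, 1]))))
             (.tiling [4, 5, 0, 8, 6, 2, 7, 3] [6, 7, 9, 3, 4, 5, 2, 0]))
            (.tiling [4, 5, 2, 8, 6, 7, 0, 1] [6, 7, 1, 9, 4, 5, 2, 0])))))
        (.split 0 5
         (.split 1 5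
          (.triple [0, 1, 5, 8] [0, 1, 9, 5])
          (.split 1 4
           (.split 5 6
            (.split 0 7
             (.split 0 6
              (.triple [0, 8, 6, 7] [0, 6, 7, 9])
              (.split 4 6
               (.tiling [4, 0, 5, 8, 6, 7, 1, 2] [0, 7, 1, 9, 4, 5, 6, 2])
               (.split 3 6
                (.tiling [3, 4, 0, 8, 6, 7, 1, 2] [7, 1, 2, 9, 3, 6, 4, 0])
                (.tiling [5, 2, 3, 8, 6, 0, 7, 1] [0, 7, 1, 9, 5, 6, 2, 3]))))
             (.split 4 6
              (.tiling [4, 0, 5, 8, 6, 7, 1, 2] [7, 0, 1, 9, 4, 5, 6, 2])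
              (.split 3 6
               (.tiling [3, 4, 0, 8, 6, 7, 1, 2] [7, 2, 0, 9, 3, 6, 1, 4])
               (.tiling [3, 4, 0, 8, 6, 7, 1, 2] [7, 2, 0, 9, 6, 3, 1, 4]))))
            (.split 0 6
             (.split 0 7
              (.triple [0, 8, 6, 7] [0, 6, 7, 9])
              (.split 4 6
               (.tiling [4, 0, 5, 8, 6, 7, 1, 2] [7, 0, 1, 9, 4, 6, 5, 2])
               (.tiling [4, 0, 5, 8, 6, 7, 1, 2] [7, 0, 1, 9, 6, 4, 5, 2])))
             (.split 4 6
              (.tiling [4, 0, 5, 8, 6, 7, 1, 2] [7, 1, 2, 9, 4, 6, 0, 5])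
              (.tiling [4, 0, 5, 8, 6, 7, 1, 2] [7, 1, 2, 9, 6, 4, 0, 5]))))
           (.tiling [4, 0, 5, 8, 6, 7, 1, 2] [6, 7, 2, 9, 4, 0, 5, 1])))
         (.tiling [4, 5, 0, 8, 6, 7, 1, 2] [6, 7, 1, 9, 4, 5, 2, 0])))))
     (.split 2 7
      (.split 0 7
       (.triple [2, 0, 8, 7] [2, 0, 7, 9])
       (.split 0 6
        (.split 4 6
         (.split 3 7
          (.split 1 4
           (.split 1 3
            (.triple [1, 3, 4, 8] [1, 9, 3, 4])
            (.split 3 6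
             (.tiling [4, 2, 0, 8, 3, 6, 7, 1] [6, 7, 1, 9, 3, 4, 2, 0])
             (.tiling [4, 2, 0, 8, 6, 3, 7, 1] [6, 7, 1, 9, 3, 4, 2, 0])))
           (.tiling [3, 2, 8, 7, 4, 0, 6, 1] [6, 7, 1, 9, 3, 4, 2, 0]))
          (.split 1 3
           (.split 1 4
            (.triple [1, 3, 4, 8] [1, 9, 3, 4])
            (.split 1 5
             (.triple [1, 5, 3, 8] [1, 9, 5, 3])
             (.split 5 7
              (.split 5 6
               (.tiling [4, 2, 0, 8, 5, 6, 7, 1] [2, 7, 0, 9, 4, 5, 6, 1])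
               (.tiling [4, 2, 0, 8, 6, 5, 7, 1] [2, 7, 0, 9, 4, 6, 5, 1]))
              (.tiling [4, 0, 8, 6, 7, 5, 1, 3] [7, 9, 5, 3, 4, 0, 6, 1]))))
           (.split 3 6
            (.split 4 7
             (.tiling [3, 0, 1, 8, 4, 6, 2, 7] [6, 7, 1, 9, 3, 4, 2, 0])
             (.split 2 5
              (.split 0 5
               (.triple [2, 0, 5, 8] [2, 0, 9, 5])
               (.split 5 7
                (.tiling [2, 5, 8, 7, 3, 0, 6, 1] [6, 1, 2, 9, 5, 7, 3, 0])
                (.tiling [3, 4, 8, 6, 2, 7, 5, 0] [2, 7, 9, 5, 3, 4, 0, 6])))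
              (.split 5 6
               (.split 5 7
                (.tiling [3, 0, 1, 8, 5, 6, 2, 7] [7, 0, 1, 9, 5, 3, 6, 2])
                (.tiling [4, 5, 8, 6, 7, 3, 0, 1] [7, 9, 4, 5, 3, 0, 6, 1]))
               (.split 1 5
                (.tiling [3, 4, 0, 8, 6, 1, 5, 2] [6, 1, 9, 5, 3, 4, 2, 0])
                (.split 5 7
                 (.tiling [3, 4, 2, 8, 6, 5, 7, 1] [7, 9, 3, 4, 6, 5, 1, 2])
                 (.tiling [3, 4, 2, 8, 6, 7, 5, 1] [7, 9, 3, 4, 6, 5, 1, 2]))))))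
            (.tiling [4, 2, 0, 8, 6, 7, 3, 1] [6, 7, 1, 9, 3, 4, 2, 0]))))
         (.split 1 4
          (.split 1 3
           (.triple [1, 3, 4, 8] [1, 9, 3, 4])
           (.split 4 7
            (.tiling [3, 0, 1, 8, 6, 4, 2, 7] [6, 7, 1, 9, 3, 4, 2, 0])
            (.tiling [3, 2, 0, 8, 6, 7, 1, 4] [6, 7, 1, 9, 3, 4, 2, 0])))
          (.split 4 7
           (.tiling [3, 2, 0, 8, 6, 4, 7, 1] [6, 7, 1, 9, 3, 4, 2, 0])
           (.tiling [3, 2, 0, 8, 6, 7, 4, 1] [6, 7, 1, 9, 3, 4, 2, 0]))))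
        (.tiling [3, 4, 2, 8, 6, 7, 0, 1] [6, 7, 1, 9, 3, 4, 2, 0])))
      (.tiling [3, 4, 0, 8, 6, 7, 1, 2] [6, 7, 1, 9, 3, 4, 2, 0]))))

/-- A configuration normalised by `IsConfig.rotate_left` and `IsConfig.rotate_right`. -/
theorem IsConfig.linked_of_adj (h : G.IsConfig x y T a₀ a₁ a₂ b₀ b₁ b₂ c₀ c₁)
    (hs : G.IsSetup x y T) (h₁ : G.adj c₀ a₁) (h₂ : G.adj c₀ a₂) (h₃ : G.adj b₀ a₀)
    (h₄ : G.adj b₁ a₀) : G.Linked x y T :=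
  h.linked_of_valid hs configTree [(6, 1), (6, 2), (3, 0), (4, 0)] (by simp [*])
    (by decide +kernel)

theorem IsConfig.linked_of_adj_adj (h : G.IsConfig x y T a₀ a₁ a₂ b₀ b₁ b₂ c₀ c₁)
    (hs : G.IsSetup x y T) (h₁ : G.adj c₀ a₁) (h₂ : G.adj c₀ a₂) : G.Linked x y T := by
  have hfork : ∀ {b₀ b₁ b₂ : V}, G.IsConfig x y T a₀ a₁ a₂ b₀ b₁ b₂ c₀ c₁ → G.adj a₀ b₀ →
      G.adj a₀ b₁ → G.Linked x y T := fun h h₃ h₄ =>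
    h.linked_of_valid hs (.triple [0, 3, 4, 8] [0, 9, 3, 4]) [(0, 3), (0, 4)] (by simp [*])
      (by decide +kernel)
  have hadj : ∀ b ∈ G.typeClass x y T True False, G.adj b a₀ ∨ G.adj a₀ b := fun b hb =>
    hs.tournament b (mem_typeClass.1 hb).1 a₀ (mem_typeClass.1 h.a₀_mem).1 <| by
      rintro rfl
      exact ((mem_typeClass.1 hb).2.2.1 ((mem_typeClass.1 h.a₀_mem).2.2.2 trivial)).elim
  have h' := h.rotate_right
  have h'' := h'.rotate_right
  rcases hadj _ h.b₀_mem with hb₀ | hb₀ <;> rcases hadj _ h.b₁_mem with hb₁ | hb₁ <;>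
    rcases hadj _ h.b₂_mem with hb₂ | hb₂
  · exact h.linked_of_adj hs h₁ h₂ hb₀ hb₁
  · exact h.linked_of_adj hs h₁ h₂ hb₀ hb₁
  · exact h''.linked_of_adj hs h₁ h₂ hb₂ hb₀
  · exact hfork h' hb₁ hb₂
  · exact h'.linked_of_adj hs h₁ h₂ hb₁ hb₂
  · exact hfork h'' hb₂ hb₀
  · exact hfork h hb₀ hb₁
  · exact hfork h hb₀ hb₁

theorem IsConfig.linked (h : G.IsConfig x y T a₀ a₁ a₂ b₀ b₁ b₂ c₀ c₁)
    (hs : G.IsSetup x y T) : G.Linked x y T := by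
  have hfork : ∀ {a₀ a₁ a₂ : V}, G.IsConfig x y T a₀ a₁ a₂ b₀ b₁ b₂ c₀ c₁ → G.adj a₁ c₀ →
      G.adj a₂ c₀ → G.Linked x y T := fun h h₃ h₄ =>
    h.linked_of_valid hs (.triple [1, 2, 8, 6] [1, 2, 6, 9]) [(1, 6), (2, 6)] (by simp [*])
      (by decide +kernel)
  have hadj : ∀ a ∈ G.typeClass x y T True True, G.adj a c₀ ∨ G.adj c₀ a := fun a ha =>
    hs.tournament a (mem_typeClass.1 ha).1 c₀ (mem_typeClass.1 h.c₀_mem).1 <| by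
      rintro rfl
      exact ((mem_typeClass.1 h.c₀_mem).2.1.1 ((mem_typeClass.1 ha).2.1.2 trivial)).elim
  have h' := h.rotate_left
  have h'' := h'.rotate_left
  rcases hadj _ h.a₀_mem with ha₀ | ha₀ <;> rcases hadj _ h.a₁_mem with ha₁ | ha₁ <;>
    rcases hadj _ h.a₂_mem with ha₂ | ha₂
  · exact hfork h ha₁ ha₂
  · exact hfork h'' ha₀ ha₁
  · exact hfork h' ha₂ ha₀
  · exact h.linked_of_adj_adj hs ha₁ ha₂
  · exact hfork h ha₁ ha₂
  · exact h'.linked_of_adj_adj hs ha₂ ha₀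
  · exact h''.linked_of_adj_adj hs ha₀ ha₁
  · exact h.linked_of_adj_adj hs ha₁ ha₂

theorem IsSetup.linked_of_card (hs : G.IsSetup x y T)
    (hA : 3 ≤ (G.typeClass x y T True True).card) (hB : 3 ≤ (G.typeClass x y T True False).card)
    (hC : 2 ≤ (G.typeClass x y T False True).card) : G.Linked x y T := by
  by_contra hL
  have hcyc := fun {p q : Prop} =>
    typeClass_cyclic (p := p) (q := q) hs.1 hs.3 hs.4 hs.2 hs.5 hs.6 hL
  obtain ⟨-, a₀, ha₀, a₁, ha₁, a₂, ha₂, ha⟩ := hcyc hA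
  obtain ⟨-, b₀, hb₀, b₁, hb₁, b₂, hb₂, hb⟩ := hcyc hB
  obtain ⟨c₀, hc₀, c₁, hc₁, hc⟩ := one_lt_card.1 hC
  rcases hs.tournament c₀ (typeClass_subset _ _ hc₀) c₁ (typeClass_subset _ _ hc₁) hc with h | h
  · exact hL (IsConfig.linked ⟨ha₀, ha₁, ha₂, hb₀, hb₁, hb₂, hc₀, hc₁, ha.1, ha.2.1, ha.2.2,
      hb.1, hb.2.1, hb.2.2, h⟩ hs)
  · exact hL (IsConfig.linked ⟨ha₀, ha₁, ha₂, hb₀, hb₁, hb₂, hc₁, hc₀, ha.1, ha.2.1, ha.2.2,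
      hb.1, hb.2.1, hb.2.2, h⟩ hs)

theorem IsSetup.linked (hs : G.IsSetup x y T) : G.Linked x y T := by
  by_contra hL
  have hle : ∀ p q : Prop, (G.typeClass x y T p q).card ≤ 3 := by
    intro p q
    by_contra! h
    have := (typeClass_cyclic hs.1 hs.3 hs.4 hs.2 hs.5 hs.6 hL h.le).1
    omega
  have hsum := card_le_sum_card_typeClass (G := G) (x := x) (y := y) (T := T)
  rw [hs.card] at hsum
  have hA := hle True True
  have hB := hle True False
  have hC := hle False True
  have hD := hle False False
  by_cases hA3 : 3 ≤ (G.typeClass x y T True True).card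
  · by_cases hB3 : 3 ≤ (G.typeClass x y T True False).card
    · exact hL (hs.linked_of_card hA3 hB3 (by omega))
    · refine hL (hs.swap.linked_of_card ?_ ?_ ?_).symm <;> rw [typeClass_swap] <;> omega
  · refine hL (hs.rev.linked_of_card ?_ ?_ ?_).of_rev <;> rw [typeClass_rev hs.5 hs.6] <;>
      simp only [not_true_eq_false, not_false_eq_true] <;> omega

end OrientedGraph

/-- If `x, y ∈ V(G)` and `T ⊆ V(G) \ {x, y}` with `|T| = 11` are such that both
`{x} ∪ T` and `{y} ∪ T` induce tournaments in `G`, then there is `Z ⊆ T` with `|Z| = 7`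
such that both `G[{x} ∪ Z]` and `G[{y} ∪ Z]` have perfect `T_4`-tilings. -/
theorem stmt_19 {V : Type*} [DecidableEq V] (G : OrientedGraph V) (x y : V)
    (T : Finset V) (hxT : x ∉ T) (hyT : y ∉ T) (hcard : T.card = 11)
    (htx : ∀ u ∈ insert x T, ∀ v ∈ insert x T, u ≠ v → G.adj u v ∨ G.adj v u)
    (hty : ∀ u ∈ insert y T, ∀ v ∈ insert y T, u ≠ v → G.adj u v ∨ G.adj v u) :
    ∃ Z ⊆ T, Z.card = 7 ∧
      (∃ A B : Finset V, A ∪ B = insert x Z ∧ Disjoint A B ∧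
        G.IsTTCopy 4 A ∧ G.IsTTCopy 4 B) ∧
      (∃ A B : Finset V, A ∪ B = insert y Z ∧ Disjoint A B ∧
        G.IsTTCopy 4 A ∧ G.IsTTCopy 4 B) := by
  have hs : G.IsSetup x y T :=
    ⟨fun u hu v hv => htx u (mem_insert_of_mem hu) v (mem_insert_of_mem hv), hcard, hxT, hyT,
      fun v hv => htx v (mem_insert_of_mem hv) x (mem_insert_self x T) (fun h => hxT (h ▸ hv)),
      fun v hv => hty v (mem_insert_of_mem hv) y (mem_insert_self y T) (fun h => hyT (h ▸ hv))⟩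
  exact hs.linked
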